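/- arXiv:1303.2274 — 2 statements merged into one kernel-verified Lean document; each statement's English description precedes it below -/
import Mathlib

section
/- Suppose there are integers j and k with 1 ≤ j ≤ k ≤ l−1 such that n_j ≥ 3 and u_j + u_{j+1} + v_j + v_{j+1} ≤ q. Define n'_i := n_i for i ≠ k and n'_k := n_k + 1, and let u'_s, v'_s, q' denote the corresponding quantities for the string [n'_1, …, n'_l]. Then u'_j + u'_{j+1} + v'_j + v'_{j+1} ≤ q'. -/
/-- The `l × l` symmetric tridiagonal intersection matrix `M(-n₁, …, -n_l)`,
where the entries `n 1, …, n l` of `n : ℕ → ℤ` are used (1-based indexing). -/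
def HJMat (l : ℕ) (n : ℕ → ℤ) : Matrix (Fin l) (Fin l) ℤ :=
  Matrix.of fun i j =>
    if i = j then -(n (i.val + 1))
    else if i.val + 1 = j.val ∨ j.val + 1 = i.val then 1 else 0

/-- `|[n₁, …, n_l]| = |det M(-n₁, …, -n_l)|` (with `|[]| = 1` for `l = 0`). -/
def HJdet (l : ℕ) (n : ℕ → ℤ) : ℤ := |(HJMat l n).det|

/-- `u`-sequence: `u 0 = 0` and `u s = |[n₁, …, n_{s-1}]|` for `s ≥ 1`. -/
def HJu (n : ℕ → ℤ) : ℕ → ℤ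
  | 0 => 0
  | s + 1 => HJdet s n

/-- `v`-sequence: `v s = |[n_{s+1}, …, n_l]|` for `0 ≤ s ≤ l`, and `v s = 0` for `s > l`. -/
def HJv (l : ℕ) (n : ℕ → ℤ) (s : ℕ) : ℤ :=
  if s ≤ l then HJdet (l - s) (fun i => n (s + i)) else 0

/-- `q = |[n₁, …, n_l]|`. -/
def HJq (l : ℕ) (n : ℕ → ℤ) : ℤ := HJdet l n

/-- `continuant n s` is the Hirzebruch-Jung continuant of `n 1, …, n (s - 1)`, with
`continuant n 0 = 0`. -/
def continuant : (ℕ → ℤ) → ℕ → ℤ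
  | _, 0 => 0
  | _, 1 => 1
  | n, s + 2 =>
    n 1 * continuant (fun i => n (1 + i)) (s + 1) - continuant (fun i => n (2 + i)) s

theorem continuant_one (n : ℕ → ℤ) : continuant n 1 = 1 :=
  rfl

theorem continuant_add_two (n : ℕ → ℤ) (s : ℕ) :
    continuant n (s + 2) =
      n 1 * continuant (fun i => n (1 + i)) (s + 1) - continuant (fun i => n (2 + i)) s :=
  rfl

theorem det_HJMat_add_two (l : ℕ) (n : ℕ → ℤ) :
    (HJMat (l + 2) n).det =
      -(n 1) * (HJMat (l + 1) fun i => n (1 + i)).det - (HJMat l fun i => n (2 + i)).det := by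
  have h0 : (HJMat (l + 2) n).submatrix Fin.succ (Fin.succAbove 0) =
      HJMat (l + 1) fun i => n (1 + i) := by
    ext i j
    simp [HJMat, add_comm 1]
  have h1 : ((HJMat (l + 2) n).submatrix Fin.succ (Fin.succAbove 1)).det =
      (HJMat l fun i => n (2 + i)).det := by
    rw [Matrix.det_succ_column_zero, Fin.sum_univ_succ, Finset.sum_eq_zero]
    · have : ((HJMat (l + 2) n).submatrix Fin.succ (Fin.succAbove 1)).submatrix
          (Fin.succAbove 0) Fin.succ = HJMat l fun i => n (2 + i) := by
        ext i j
        have : (1 : Fin (l + 2)).succAbove j.succ = j.succ.succ := by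
          rw [← Fin.succ_zero_eq_one, Fin.succ_succAbove_succ, Fin.succAbove_zero]
        simp [HJMat, this, add_comm, add_left_comm]
      rw [this]
      simp [HJMat]
    · intro i _
      simp [HJMat, Fin.ext_iff]
  rw [Matrix.det_succ_row_zero, Fin.sum_univ_succ, Fin.sum_univ_succ, Finset.sum_eq_zero]
  · rw [h0, Fin.succ_zero_eq_one, h1]
    simp [HJMat]
    ring
  · intro i _
    simp [HJMat, Fin.ext_iff]

theorem det_HJMat (l : ℕ) (n : ℕ → ℤ) :
    (HJMat l n).det = (-1) ^ l * continuant n (l + 1) := by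
  induction l using Nat.twoStepInduction generalizing n with
  | zero => simp [continuant]
  | one => simp [HJMat, continuant]
  | more l ih ih' =>
    rw [det_HJMat_add_two, ih, ih', show l + 2 + 1 = l + 1 + 2 by rfl,
      continuant_add_two n (l + 1)]
    ring

/-- Splitting a continuant into the parts before and after a given position. -/
theorem continuant_add_succ (n : ℕ → ℤ) (a b : ℕ) :
    continuant n (a + b + 1) =
      continuant n (a + 1) * continuant (fun i => n (a + i)) (b + 1) -
        continuant n a * continuant (fun i => n (a + 1 + i)) b := by
  induction a using Nat.twoStepInduction generalizing n with
  | zero => simp [continuant]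
  | one => simp [continuant, show 1 + b + 1 = b + 2 by ring]
  | more a ih ih' =>
    rw [show a + 2 + b + 1 = (a + b + 1) + 2 by ring, continuant_add_two n,
      show a + b + 1 + 1 = a + 1 + b + 1 by ring, ih, ih', show a + 2 + 1 = a + 1 + 2 by rfl,
      continuant_add_two n a, continuant_add_two n (a + 1)]
    simp only [← add_assoc]
    rw [show 1 + a + 1 = a + 2 by ring, show 2 + a = a + 2 by ring]
    ring

theorem continuant_succ_succ (n : ℕ → ℤ) (s : ℕ) :
    continuant n (s + 2) = n (s + 1) * continuant n (s + 1) - continuant n s := by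
  rw [show s + 2 = s + 1 + 1 by rfl, continuant_add_succ n s 1]
  simp [continuant, mul_comm]

theorem continuant_congr {n n' : ℕ → ℤ} {s : ℕ} (h : ∀ i, 1 ≤ i → i < s → n i = n' i) :
    continuant n s = continuant n' s := by
  induction s using Nat.twoStepInduction with
  | zero => rfl
  | one => rfl
  | more s ih ih' =>
    rw [continuant_succ_succ, continuant_succ_succ, h (s + 1) (by omega) (by omega),
      ih fun i h1 h2 => h i h1 (by omega), ih' fun i h1 h2 => h i h1 (by omega)]

theorem continuant_lt_succ {n : ℕ → ℤ} {s : ℕ} (h : ∀ i, 1 ≤ i → i ≤ s → 2 ≤ n i) :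
    0 ≤ continuant n s ∧ continuant n s < continuant n (s + 1) := by
  induction s with
  | zero => simp [continuant]
  | succ s ih =>
    obtain ⟨h0, h1⟩ := ih fun i h1 h2 => h i h1 (by omega)
    refine ⟨by linarith, ?_⟩
    rw [continuant_succ_succ]
    nlinarith [h (s + 1) (by omega) le_rfl]

theorem continuant_tail_le {n : ℕ → ℤ} {s : ℕ} (h : ∀ i, 1 ≤ i → i ≤ s → 2 ≤ n i) :
    continuant (fun i => n (1 + i)) s ≤ continuant n (s + 1) := by
  induction s generalizing n with
  | zero => simp [continuant]
  | succ s ih =>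
    have htail := ih (n := fun i => n (1 + i)) fun i h1 h2 => h _ (by omega) (by omega)
    have hpos := continuant_lt_succ (n := fun i => n (1 + i)) (s := s)
      fun i h1 h2 => h _ (by omega) (by omega)
    simp only [← add_assoc, show 1 + 1 = 2 by rfl] at htail
    rw [continuant]
    nlinarith [h 1 le_rfl (by omega)]

theorem continuant_eq_add_mul_of_bump {n n' : ℕ → ℤ} {k b : ℕ}
    (h : ∀ i, i ≠ k + 1 → n' i = n i) (hk : n' (k + 1) = n (k + 1) + 1) :
    continuant n' (k + 1 + b + 1) = continuant n (k + 1 + b + 1) +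
      continuant n (k + 1) * continuant (fun i => n (k + 1 + i)) (b + 1) := by
  rw [continuant_add_succ n', continuant_add_succ n, continuant_succ_succ n',
    continuant_succ_succ n, hk,
    continuant_congr (n := n') (n' := n) (s := k) fun i h1 h2 => h i (by omega),
    continuant_congr (n := n') (n' := n) (s := k + 1) fun i h1 h2 => h i (by omega),
    continuant_congr (n' := fun i => n (k + 1 + i)) fun i h1 h2 => h (k + 1 + i) (by omega),
    continuant_congr (n' := fun i => n (k + 1 + 1 + i))
      fun i h1 h2 => h (k + 1 + 1 + i) (by omega)]
  ring

theorem HJdet_eq_continuant {l : ℕ} {n : ℕ → ℤ} (h : ∀ i, 1 ≤ i → i ≤ l → 2 ≤ n i) :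
    HJdet l n = continuant n (l + 1) := by
  have := continuant_lt_succ h
  rw [HJdet, det_HJMat, abs_mul, abs_pow, abs_neg, abs_one, one_pow, one_mul,
    abs_of_nonneg (by linarith)]

theorem HJq_eq_continuant {l : ℕ} {n : ℕ → ℤ} (h : ∀ i, 1 ≤ i → i ≤ l → 2 ≤ n i) :
    HJq l n = continuant n (l + 1) :=
  HJdet_eq_continuant h

theorem HJu_eq_continuant {s : ℕ} {n : ℕ → ℤ} (h : ∀ i, 1 ≤ i → i < s → 2 ≤ n i) :
    HJu n s = continuant n s := by
  cases s with
  | zero => rfl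
  | succ s => exact HJdet_eq_continuant fun i h1 h2 => h i h1 (by omega)

theorem HJv_eq_continuant {l s : ℕ} {n : ℕ → ℤ} (hs : s ≤ l)
    (h : ∀ i, s < i → i ≤ l → 2 ≤ n i) :
    HJv l n s = continuant (fun i => n (s + i)) (l + 1 - s) := by
  rw [HJv, if_pos hs, HJdet_eq_continuant fun i h1 h2 => h _ (by omega) (by omega),
    show l + 1 - s = l - s + 1 by omega]

/-- Lemma 3.12: if `n_j ≥ 3` and `u_j + u_{j+1} + v_j + v_{j+1} ≤ q` for some
`1 ≤ j ≤ k ≤ l - 1`, then after replacing `n_k` by `n_k + 1` the analogous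
inequality `u'_j + u'_{j+1} + v'_j + v'_{j+1} ≤ q'` still holds. -/
theorem hj_bump_preserves_ineq (l : ℕ) (n : ℕ → ℤ) (hl : 1 ≤ l)
    (hn : ∀ i, 1 ≤ i → i ≤ l → 2 ≤ n i)
    (j k : ℕ) (hj : 1 ≤ j) (hjk : j ≤ k) (hkl : k + 1 ≤ l)
    (hnj : 3 ≤ n j)
    (h : HJu n j + HJu n (j + 1) + HJv l n j + HJv l n (j + 1) ≤ HJq l n) :
    HJu (Function.update n k (n k + 1)) j
      + HJu (Function.update n k (n k + 1)) (j + 1)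
      + HJv l (Function.update n k (n k + 1)) j
      + HJv l (Function.update n k (n k + 1)) (j + 1)
      ≤ HJq l (Function.update n k (n k + 1)) := by
  obtain ⟨a, rfl⟩ : ∃ a, j = a + 1 := ⟨j - 1, by omega⟩
  obtain ⟨d, rfl⟩ : ∃ d, k = a + 1 + d := ⟨k - (a + 1), by omega⟩
  obtain ⟨e, rfl⟩ : ∃ e, l = a + 1 + d + 1 + e := ⟨l - (a + 1 + d + 1), by omega⟩
  set k := a + 1 + d with hk
  set n' := Function.update n k (n k + 1)
  have hne (i : ℕ) (hi : i ≠ k) : n' i = n i := Function.update_of_ne hi _ _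
  have hke : n' k = n k + 1 := Function.update_self _ _ _
  have hn2 (i : ℕ) (h1 : 1 ≤ i) (h2 : i ≤ k + 1 + e) : 2 ≤ n' i := by
    rcases eq_or_ne i k with rfl | hi
    · rw [hke]; linarith [hn k h1 h2]
    · rw [hne i hi]; exact hn i h1 h2
  have hq := continuant_eq_add_mul_of_bump (n := n) (n' := n') (k := k - 1) (b := e + 1)
    (fun i hi => hne i (by omega)) (by rw [Nat.sub_add_cancel (by omega), hke])
  rw [Nat.sub_add_cancel (by omega)] at hq
  have hvk := continuant_lt_succ (n := fun i => n (k + i)) (s := e + 1)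
    fun i h1 h2 => hn _ (by omega) (by omega)
  have hua := continuant_lt_succ (n := n) (s := a) fun i h1 h2 => hn i h1 (by omega)
  rw [HJq_eq_continuant hn] at h
  rw [HJq_eq_continuant hn2]
  rw [HJu_eq_continuant fun i h1 h2 => hn i h1 (by omega),
    HJu_eq_continuant fun i h1 h2 => hn i h1 (by omega),
    HJv_eq_continuant (by omega) fun i h1 h2 => hn i (by omega) h2,
    HJv_eq_continuant (by omega) fun i h1 h2 => hn i (by omega) h2] at h
  rw [HJu_eq_continuant fun i h1 h2 => hn2 i h1 (by omega),
    HJu_eq_continuant fun i h1 h2 => hn2 i h1 (by omega),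
    HJv_eq_continuant (by omega) fun i h1 h2 => hn2 i (by omega) h2,
    HJv_eq_continuant (by omega) fun i h1 h2 => hn2 i (by omega) h2]
  rw [show k + 1 + e + 1 = k + (e + 1) + 1 by omega] at h ⊢
  rw [hq]
  have huj : continuant n' (a + 1) = continuant n (a + 1) :=
    continuant_congr fun i h1 h2 => hne i (by omega)
  rw [huj]
  rcases Nat.eq_zero_or_pos d with rfl | hd
  · have hu := continuant_eq_add_mul_of_bump (n := n) (n' := n') (k := a) (b := 0)
      (fun i hi => hne i (by omega)) hke
    have hv : continuant (fun i => n' (a + 1 + i)) (k + (e + 1) + 1 - (a + 1)) =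
        continuant (fun i => n (a + 1 + i)) (k + (e + 1) + 1 - (a + 1)) :=
      continuant_congr fun i h1 h2 => hne _ (by omega)
    have hv' : continuant (fun i => n' (a + 1 + 1 + i)) (k + (e + 1) + 1 - (a + 1 + 1)) =
        continuant (fun i => n (a + 1 + 1 + i)) (k + (e + 1) + 1 - (a + 1 + 1)) :=
      continuant_congr fun i h1 h2 => hne _ (by omega)
    have hk' : k = a + 1 := hk
    rw [hk'] at hvk hv hv' h ⊢
    rw [hv, hv']
    simp only [add_zero, zero_add, continuant_one, mul_one] at hu
    rw [hu]
    nlinarith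
  · obtain ⟨c, rfl⟩ : ∃ c, d = c + 1 := ⟨d - 1, by omega⟩
    have hu : continuant n' (a + 1 + 1) = continuant n (a + 1 + 1) :=
      continuant_congr fun i h1 h2 => hne i (by omega)
    have hv := continuant_eq_add_mul_of_bump (n := fun i => n (a + 1 + i))
      (n' := fun i => n' (a + 1 + i)) (k := c) (b := e + 1)
      (fun i hi => hne _ (by omega)) (by rw [← hk, hke])
    have hv' : continuant (fun i => n' (a + 1 + 1 + i)) (c + 1 + (e + 1)) =
        continuant (fun i => n (a + 1 + 1 + i)) (c + 1 + (e + 1)) +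
          continuant (fun i => n (a + 1 + 1 + i)) c * continuant (fun i => n (k + i)) (e + 2) := by
      rcases Nat.eq_zero_or_pos c with rfl | hc
      · rw [continuant_congr fun i h1 h2 => hne (a + 1 + 1 + i) (by omega)]
        simp [continuant]
      · obtain ⟨b, rfl⟩ : ∃ b, c = b + 1 := ⟨c - 1, by omega⟩
        have := continuant_eq_add_mul_of_bump (n := fun i => n (a + 1 + 1 + i))
          (n' := fun i => n' (a + 1 + 1 + i)) (k := b) (b := e + 1)
          (fun i hi => hne _ (by omega))
          (by rw [show a + 1 + 1 + (b + 1) = k by omega, hke])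
        simp only [← add_assoc] at this
        rw [show a + 1 + 1 + b + 1 = k by omega] at this
        rw [show b + 1 + 1 + (e + 1) = b + 1 + (e + 1) + 1 by omega]
        exact this
    have huk := continuant_add_succ n (a + 1) c
    have hs := continuant_succ_succ n a
    have hA := continuant_lt_succ (n := fun i => n (a + 1 + i)) (s := c)
      fun i h1 h2 => hn _ (by omega) (by omega)
    have hB : continuant (fun i => n (a + 1 + 1 + i)) c ≤
        continuant (fun i => n (a + 1 + i)) (c + 1) := by
      have := continuant_tail_le (n := fun i => n (a + 1 + i)) (s := c)
        fun i h1 h2 => hn _ (by omega) (by omega)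
      simpa only [← add_assoc] using this
    have hle : continuant (fun i => n (a + 1 + i)) (c + 1) +
        continuant (fun i => n (a + 1 + 1 + i)) c ≤ continuant n k := by
      rw [hk, ← add_assoc, huk]
      have h2 : 2 * continuant n (a + 1) + 1 ≤ continuant n (a + 1 + 1) := by
        rw [hs]
        nlinarith
      have hA0 : 0 ≤ continuant (fun i => n (a + 1 + i)) (c + 1) := by linarith
      have h3 : 1 ≤ continuant n (a + 1) := by linarith
      generalize continuant (fun i => n (a + 1 + i)) (c + 1) = A at *
      generalize continuant (fun i => n (a + 1 + 1 + i)) c = B at *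
      nlinarith [mul_le_mul_of_nonneg_right h2 hA0,
        mul_le_mul_of_nonneg_left hB (by linarith : 0 ≤ continuant n (a + 1)),
        mul_le_mul_of_nonneg_right h3 hA0]
    have hshift : (fun i => n (a + 1 + (c + 1 + i))) = fun i => n (k + i) := by
      funext i
      congr 1
      omega
    rw [hshift] at hv
    rw [hu, show k + (e + 1) + 1 - (a + 1) = c + 1 + (e + 1) + 1 by omega,
      show k + (e + 1) + 1 - (a + 1 + 1) = c + 1 + (e + 1) by omega]
    rw [show k + (e + 1) + 1 - (a + 1) = c + 1 + (e + 1) + 1 by omega,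
      show k + (e + 1) + 1 - (a + 1 + 1) = c + 1 + (e + 1) by omega] at h
    rw [hv, hv']
    have := mul_le_mul_of_nonneg_right hle (by linarith :
      0 ≤ continuant (fun i => n (k + i)) (e + 1 + 1))
    linarith
end

section
/- If |[n_1, …, n_l]| = |[n_2, …, n_l]| + 2 (i.e. q = q_1 + 2), then n_i = 2 for all 1 ≤ i ≤ l−1 and n_l = 3; that is, [n_1, …, n_l] = [2, …, 2, 3]. -/
theorem HJMat_submatrix_succ_succ (l : ℕ) (n : ℕ → ℤ) :
    (HJMat (l + 1) n).submatrix Fin.succ Fin.succ = HJMat l (fun i => n (1 + i)) := by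
  ext i j
  simp [HJMat, Matrix.submatrix_apply, Fin.ext_iff, add_comm, add_left_comm]

/-- Expansion of the tridiagonal determinant along its first row. -/
theorem HJMat_det_succ_succ (l : ℕ) (n : ℕ → ℤ) :
    (HJMat (l + 2) n).det = -n 1 * (HJMat (l + 1) (fun i => n (1 + i))).det
      - (HJMat l (fun i => n (1 + (1 + i)))).det := by
  have minor : ((HJMat (l + 2) n).submatrix Fin.succ (Fin.succAbove 1)).det
      = (HJMat l (fun i => n (1 + (1 + i)))).det := by
    rw [Matrix.det_succ_column_zero, Fin.sum_univ_succ, Finset.sum_eq_zero]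
    · have hsub : ((HJMat (l + 2) n).submatrix Fin.succ (Fin.succAbove 1)).submatrix
          (Fin.succAbove 0) Fin.succ = HJMat l (fun i => n (1 + (1 + i))) := by
        rw [← HJMat_submatrix_succ_succ l (fun i => n (1 + i)),
          ← HJMat_submatrix_succ_succ (l + 1) n]
        ext i j
        have hj : Fin.succAbove (1 : Fin (l + 2)) j.succ = j.succ.succ := by
          rw [← Fin.succ_zero_eq_one, Fin.succ_succAbove_succ, Fin.succAbove_zero]
        simp [Matrix.submatrix_apply, hj]
      rw [hsub]
      simp [HJMat]
    · intro i _
      simp [HJMat, Fin.ext_iff]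
  rw [Matrix.det_succ_row_zero, Fin.sum_univ_succ, Fin.sum_univ_succ, Finset.sum_eq_zero]
  · have hsub : (HJMat (l + 2) n).submatrix Fin.succ (Fin.succAbove 0)
        = HJMat (l + 1) (fun i => n (1 + i)) := HJMat_submatrix_succ_succ (l + 1) n
    rw [hsub, Fin.succ_zero_eq_one, minor]
    simp [HJMat]
    ring
  · intro i _
    simp [HJMat, Fin.ext_iff]

/-- With all entries at least `2`, the signed determinants are positive and strictly increase
when an entry is prepended. -/
theorem HJMat_signed_det_pos_and_lt (l : ℕ) (n : ℕ → ℤ) (hn : ∀ i, 1 ≤ i → i ≤ l + 1 → 2 ≤ n i) :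
    0 < (-1) ^ l * (HJMat l (fun i => n (1 + i))).det ∧
      (-1) ^ l * (HJMat l (fun i => n (1 + i))).det < (-1) ^ (l + 1) * (HJMat (l + 1) n).det := by
  induction l generalizing n with
  | zero =>
    have := hn 1 le_rfl le_rfl
    simp [HJMat]
    linarith
  | succ l ih =>
    obtain ⟨hpos, hlt⟩ := ih (fun i => n (1 + i)) fun i _ _ => hn (1 + i) (by lia) (by lia)
    have h1 := hn 1 le_rfl (by lia)
    refine ⟨hpos.trans hlt, ?_⟩
    have hmul := mul_nonneg (sub_nonneg.2 h1) (hpos.trans hlt).le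
    rw [HJMat_det_succ_succ]
    linear_combination hlt + hmul

theorem HJdet_eq_signed_det (l : ℕ) (n : ℕ → ℤ) (hn : ∀ i, 1 ≤ i → i ≤ l → 2 ≤ n i) :
    HJdet l n = (-1) ^ l * (HJMat l n).det := by
  have hpos : 0 < (-1) ^ l * (HJMat l n).det := by
    cases l with
    | zero => simp
    | succ l =>
      obtain ⟨h0, h1⟩ := HJMat_signed_det_pos_and_lt l n hn
      exact h0.trans h1
  rw [HJdet, ← abs_of_pos hpos, abs_mul, abs_pow]
  simp

theorem HJdet_pos_and_lt (l : ℕ) (n : ℕ → ℤ) (hn : ∀ i, 1 ≤ i → i ≤ l + 1 → 2 ≤ n i) :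
    0 < HJdet l (fun i => n (1 + i)) ∧ HJdet l (fun i => n (1 + i)) < HJdet (l + 1) n := by
  rw [HJdet_eq_signed_det l _ fun i _ _ => hn (1 + i) (by lia) (by lia),
    HJdet_eq_signed_det (l + 1) n hn]
  exact HJMat_signed_det_pos_and_lt l n hn

theorem HJdet_succ_succ (l : ℕ) (n : ℕ → ℤ) (hn : ∀ i, 1 ≤ i → i ≤ l + 2 → 2 ≤ n i) :
    HJdet (l + 2) n
      = n 1 * HJdet (l + 1) (fun i => n (1 + i)) - HJdet l (fun i => n (1 + (1 + i))) := by
  rw [HJdet_eq_signed_det (l + 2) n hn,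
    HJdet_eq_signed_det (l + 1) _ fun i _ _ => hn (1 + i) (by lia) (by lia),
    HJdet_eq_signed_det l _ fun i _ _ => hn (1 + (1 + i)) (by lia) (by lia),
    HJMat_det_succ_succ]
  ring

theorem entries_of_HJdet_succ_eq_add_two (l : ℕ) (n : ℕ → ℤ)
    (hn : ∀ i, 1 ≤ i → i ≤ l + 1 → 2 ≤ n i)
    (h : HJdet (l + 1) n = HJdet l (fun i => n (1 + i)) + 2) :
    (∀ i, 1 ≤ i → i < l + 1 → n i = 2) ∧ n (l + 1) = 3 := by
  induction l generalizing n with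
  | zero =>
    refine ⟨by lia, ?_⟩
    rw [HJdet_eq_signed_det _ n hn] at h
    simpa [HJdet, HJMat] using h
  | succ l ih =>
    have hn' : ∀ i, 1 ≤ i → i ≤ l + 1 → 2 ≤ n (1 + i) :=
      fun i _ _ => hn (1 + i) (by lia) (by lia)
    obtain ⟨hpos, hlt⟩ := HJdet_pos_and_lt l (fun i => n (1 + i)) hn'
    rw [HJdet_succ_succ l n hn] at h
    have h1 : n 1 = 2 := by
      have := hn 1 le_rfl (by lia)
      by_contra hne
      have h3 : 3 ≤ n 1 := by lia
      nlinarith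
    rw [h1] at h
    obtain ⟨htwo, hlast⟩ := ih (fun i => n (1 + i)) hn' (by linarith)
    refine ⟨fun i hi hil => ?_, by rwa [add_comm]⟩
    obtain rfl | hi' := hi.eq_or_lt
    · exact h1
    · obtain ⟨j, rfl⟩ := Nat.exists_eq_add_of_le hi
      exact htwo j (by lia) (by lia)

/-- Proposition 3.14(3), computation: if `q = q₁ + 2` then
`[n₁, …, n_l] = [2, …, 2, 3]`. -/
theorem hj_q_eq_q1_add_two (l : ℕ) (n : ℕ → ℤ) (hl : 1 ≤ l)
    (hn : ∀ i, 1 ≤ i → i ≤ l → 2 ≤ n i)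
    (h : HJq l n = HJv l n 1 + 2) :
    (∀ i, 1 ≤ i → i < l → n i = 2) ∧ n l = 3 := by
  obtain ⟨k, rfl⟩ := Nat.exists_eq_add_of_le' hl
  rw [HJq, HJv, if_pos hl, Nat.add_sub_cancel] at h
  exact entries_of_HJdet_succ_eq_add_two k n hn h
end
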